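/- (Necessity of α − σ ≤ 1 in the boundary case of the weighted Caffarelli–Kohn–Nirenberg inequality.) Let p, q, r, a, α, β, σ be real numbers with 1 < p < Q, q ≥ 1, r > 0, 0 < a ≤ 1, and set γ = aσ + (1−a)β. Assume d + μ(α−γ)r > 0, d + μ(α−β)q > 0, αp + Q > 0, βq + Q > 0, γr + Q > 0, the dimensional balance 1/r + γ/Q = a(1/p + (α−1)/Q) + (1−a)(1/q + β/Q), and in addition 1/p + (α−1)/Q = 1/r + γ/Q. If there exists a constant C > 0 such that for every u ∈ C_0^∞(ℝ^{d+k}) one has (∫_{ℝ^{d+k}} (|x|^μ/ρ^μ)^{(α−γ)r} ρ^{γr} |u|^r dx dy)^{1/r} ≤ C (∫_{ℝ^{d+k}} ρ^{αp} |∇_μ u|^p dx dy)^{a/p} (∫_{ℝ^{d+k}} (|x|^μ/ρ^μ)^{(α−β)q} ρ^{βq} |u|^q dx dy)^{(1−a)/q}, then necessarily α − σ ≤ 1. -/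

import Mathlib

open MeasureTheory Real
open scoped RealInnerProductSpace ENNReal

/-- The anisotropic distance function `ρ(x,y) = (|x|^{2+2μ} + (1+μ)²|y|²)^{1/(2+2μ)}`. -/
noncomputable def grho (μ : ℝ) {d k : ℕ}
    (z : EuclideanSpace ℝ (Fin d) × EuclideanSpace ℝ (Fin k)) : ℝ :=
  (‖z.1‖ ^ (2 + 2 * μ) + (1 + μ) ^ 2 * ‖z.2‖ ^ 2) ^ (1 / (2 + 2 * μ))

/-- The Grushin gradient `∇_μ u = (∇_x u, |x|^μ ∇_y u)`. -/
noncomputable def gradMu (μ : ℝ) {d k : ℕ}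
    (u : EuclideanSpace ℝ (Fin d) × EuclideanSpace ℝ (Fin k) → ℝ)
    (z : EuclideanSpace ℝ (Fin d) × EuclideanSpace ℝ (Fin k)) :
    EuclideanSpace ℝ (Fin d) × EuclideanSpace ℝ (Fin k) :=
  (gradient (fun x => u (x, z.2)) z.1, (‖z.1‖ ^ μ) • gradient (fun y => u (z.1, y)) z.2)

/-- The Euclidean-type norm `((|v₁|² + |v₂|²))^{1/2}` of a pair. -/
noncomputable def pairNorm {d k : ℕ}
    (v : EuclideanSpace ℝ (Fin d) × EuclideanSpace ℝ (Fin k)) : ℝ :=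
  Real.sqrt (‖v.1‖ ^ 2 + ‖v.2‖ ^ 2)

/-- `|∇_μ u| = (|∇_x u|² + |x|^{2μ}|∇_y u|²)^{1/2}`. -/
noncomputable def gradMuNorm (μ : ℝ) {d k : ℕ}
    (u : EuclideanSpace ℝ (Fin d) × EuclideanSpace ℝ (Fin k) → ℝ)
    (z : EuclideanSpace ℝ (Fin d) × EuclideanSpace ℝ (Fin k)) : ℝ :=
  pairNorm (gradMu μ u z)

/-- The anisotropic dilation `δ_t (x,y) = (t x, t^{1+μ} y)`. -/
noncomputable def dilation (μ t : ℝ) {d k : ℕ}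
    (z : EuclideanSpace ℝ (Fin d) × EuclideanSpace ℝ (Fin k)) :
    EuclideanSpace ℝ (Fin d) × EuclideanSpace ℝ (Fin k) :=
  (t • z.1, t ^ (1 + μ) • z.2)

/-- For `t > 0` the dilation `δ_t` is a homeomorphism. -/
noncomputable def dilationHomeomorph (μ t : ℝ) (ht : 0 < t) (d k : ℕ) :
    (EuclideanSpace ℝ (Fin d) × EuclideanSpace ℝ (Fin k)) ≃ₜ
      (EuclideanSpace ℝ (Fin d) × EuclideanSpace ℝ (Fin k)) :=
  (Homeomorph.smulOfNeZero t ht.ne').prodCongr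
    (Homeomorph.smulOfNeZero (t ^ (1 + μ)) (rpow_pos_of_pos ht _).ne')

theorem coe_dilationHomeomorph (μ t : ℝ) (ht : 0 < t) (d k : ℕ) :
    ⇑(dilationHomeomorph μ t ht d k) = dilation μ t := rfl

theorem contDiff_dilation (μ t : ℝ) {d k : ℕ} {n : WithTop ℕ∞} :
    ContDiff ℝ n (dilation μ t : EuclideanSpace ℝ (Fin d) × EuclideanSpace ℝ (Fin k) → _) := by
  unfold dilation
  fun_prop

theorem map_dilation_volume (μ t : ℝ) (ht : 0 < t) (d k : ℕ) :
    Measure.map (dilation μ t)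
        (volume : Measure (EuclideanSpace ℝ (Fin d) × EuclideanSpace ℝ (Fin k))) =
      ENNReal.ofReal (t ^ (-(d + (1 + μ) * k : ℝ))) • volume := by
  have hs : 0 < t ^ (1 + μ) := rpow_pos_of_pos ht _
  have key : (dilation μ t : EuclideanSpace ℝ (Fin d) × EuclideanSpace ℝ (Fin k) → _) =
      Prod.map (t • ·) (t ^ (1 + μ) • ·) := rfl
  rw [key, Measure.volume_eq_prod, ← Measure.map_prod_map _ _ (by fun_prop) (by fun_prop),
    Measure.map_addHaar_smul _ ht.ne', Measure.map_addHaar_smul _ hs.ne',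
    Measure.prod_smul_left, Measure.prod_smul_right, smul_smul,
    ← ENNReal.ofReal_mul (abs_nonneg _)]
  congr 2
  rw [finrank_euclideanSpace_fin, finrank_euclideanSpace_fin, abs_of_pos (by positivity),
    abs_of_pos (by positivity), ← rpow_natCast, ← rpow_natCast, ← rpow_mul ht.le,
    ← rpow_neg ht.le, ← rpow_neg ht.le, ← rpow_add ht]
  ring_nf

theorem integrable_comp_dilation {μ t : ℝ} (ht : 0 < t) {d k : ℕ}
    {f : EuclideanSpace ℝ (Fin d) × EuclideanSpace ℝ (Fin k) → ℝ} (hf : Integrable f) :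
    Integrable fun z => f (dilation μ t z) := by
  have h := (dilationHomeomorph μ t ht d k).measurableEmbedding.integrable_map_iff
    (g := f) (μ := volume)
  rw [coe_dilationHomeomorph, map_dilation_volume μ t ht] at h
  exact h.1 (hf.smul_measure ENNReal.ofReal_ne_top)

theorem integral_comp_dilation {μ t : ℝ} (ht : 0 < t) {d k : ℕ}
    (f : EuclideanSpace ℝ (Fin d) × EuclideanSpace ℝ (Fin k) → ℝ) :
    ∫ z, f (dilation μ t z) = t ^ (-(d + (1 + μ) * k : ℝ)) * ∫ z, f z := by
  have h := (dilationHomeomorph μ t ht d k).measurableEmbedding.integral_map (μ := volume) f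
  rw [coe_dilationHomeomorph, map_dilation_volume μ t ht, integral_smul_measure,
    ENNReal.toReal_ofReal (by positivity), smul_eq_mul] at h
  exact h.symm

theorem norm_dilation_fst (μ : ℝ) {t : ℝ} (ht : 0 < t) {d k : ℕ}
    (z : EuclideanSpace ℝ (Fin d) × EuclideanSpace ℝ (Fin k)) :
    ‖(dilation μ t z).1‖ = t * ‖z.1‖ := by
  simp [dilation, norm_smul, abs_of_pos ht]

theorem grho_nonneg (μ : ℝ) {d k : ℕ}
    (z : EuclideanSpace ℝ (Fin d) × EuclideanSpace ℝ (Fin k)) : 0 ≤ grho μ z := by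
  unfold grho; positivity

theorem grho_pos {μ : ℝ} {d k : ℕ}
    {z : EuclideanSpace ℝ (Fin d) × EuclideanSpace ℝ (Fin k)} (hz : z.1 ≠ 0) : 0 < grho μ z := by
  have := norm_pos_iff.2 hz
  unfold grho; positivity

theorem grho_dilation {μ t : ℝ} (hμ : 0 < μ) (ht : 0 < t) {d k : ℕ}
    (z : EuclideanSpace ℝ (Fin d) × EuclideanSpace ℝ (Fin k)) :
    grho μ (dilation μ t z) = t * grho μ z := by
  have h2 : ‖(dilation μ t z).2‖ = t ^ (1 + μ) * ‖z.2‖ := by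
    simp [dilation, norm_smul, abs_of_pos (rpow_pos_of_pos ht _)]
  have hsq : (t ^ (1 + μ)) ^ 2 = t ^ (2 + 2 * μ) := by
    rw [← rpow_natCast, ← rpow_mul ht.le]; congr 1; push_cast; ring
  have hone : (t ^ (2 + 2 * μ)) ^ (1 / (2 + 2 * μ)) = t := by
    rw [← rpow_mul ht.le, mul_one_div_cancel (by positivity), rpow_one]
  unfold grho
  rw [norm_dilation_fst μ ht, h2, mul_rpow ht.le (norm_nonneg _), mul_pow, hsq,
    show t ^ (2 + 2 * μ) * ‖z.1‖ ^ (2 + 2 * μ) + (1 + μ) ^ 2 * (t ^ (2 + 2 * μ) * ‖z.2‖ ^ 2) =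
      t ^ (2 + 2 * μ) * (‖z.1‖ ^ (2 + 2 * μ) + (1 + μ) ^ 2 * ‖z.2‖ ^ 2) by ring,
    mul_rpow (by positivity) (by positivity), hone]

theorem continuous_grho {μ : ℝ} (hμ : 0 < μ) {d k : ℕ} :
    Continuous (grho μ : EuclideanSpace ℝ (Fin d) × EuclideanSpace ℝ (Fin k) → ℝ) := by
  unfold grho
  refine Continuous.rpow_const (.add (Continuous.rpow_const (by fun_prop) fun _ => .inr ?_)
    (by fun_prop)) fun _ => .inr ?_ <;> positivity

theorem norm_gradient {E : Type*} [NormedAddCommGroup E] [InnerProductSpace ℝ E] [CompleteSpace E]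
    (f : E → ℝ) (x : E) : ‖gradient f x‖ = ‖fderiv ℝ f x‖ := by
  simp [gradient]

theorem norm_gradient_mul_comp_smul {E : Type*} [NormedAddCommGroup E] [InnerProductSpace ℝ E]
    [CompleteSpace E] (f : E → ℝ) (c s : ℝ) (x : E) :
    ‖gradient (fun y => c * f (s • y)) x‖ = |c| * |s| * ‖gradient f (s • x)‖ := by
  rw [norm_gradient, norm_gradient,
    show (fun y => c * f (s • y)) = c • fun y => f (s • y) from rfl, fderiv_const_smul_field,
    Pi.smul_apply, norm_smul, fderiv_comp_smul, norm_smul, norm_eq_abs, norm_eq_abs, mul_assoc]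

theorem gradMuNorm_eq (μ : ℝ) {d k : ℕ}
    (u : EuclideanSpace ℝ (Fin d) × EuclideanSpace ℝ (Fin k) → ℝ)
    (z : EuclideanSpace ℝ (Fin d) × EuclideanSpace ℝ (Fin k)) :
    gradMuNorm μ u z = √(‖gradient (fun x => u (x, z.2)) z.1‖ ^ 2 +
      (‖z.1‖ ^ μ * ‖gradient (fun y => u (z.1, y)) z.2‖) ^ 2) := by
  simp only [gradMuNorm, pairNorm, gradMu, norm_smul, norm_eq_abs]
  rw [abs_of_nonneg (by positivity)]

theorem gradMuNorm_mul_comp_dilation {μ c t : ℝ} (hc : 0 ≤ c) (ht : 0 < t) {d k : ℕ}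
    (u : EuclideanSpace ℝ (Fin d) × EuclideanSpace ℝ (Fin k) → ℝ)
    (z : EuclideanSpace ℝ (Fin d) × EuclideanSpace ℝ (Fin k)) :
    gradMuNorm μ (fun w => c * u (dilation μ t w)) z =
      c * t * gradMuNorm μ u (dilation μ t z) := by
  have hx := norm_gradient_mul_comp_smul (fun x => u (x, t ^ (1 + μ) • z.2)) c t z.1
  have hy := norm_gradient_mul_comp_smul (fun y => u (t • z.1, y)) c (t ^ (1 + μ)) z.2
  rw [gradMuNorm_eq, gradMuNorm_eq, norm_dilation_fst μ ht]
  simp only [dilation]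
  rw [hx, hy, abs_of_nonneg hc, abs_of_pos ht, abs_of_pos (by positivity),
    mul_rpow ht.le (norm_nonneg _), rpow_add ht, rpow_one]
  generalize ‖gradient (fun x => u (x, (t * t ^ μ) • z.2)) (t • z.1)‖ = A
  generalize ‖gradient (fun y => u (t • z.1, y)) ((t * t ^ μ) • z.2)‖ = B
  rw [show (c * t * A) ^ 2 + (‖z.1‖ ^ μ * (c * (t * t ^ μ) * B)) ^ 2 =
    (c * t) ^ 2 * (A ^ 2 + (t ^ μ * ‖z.1‖ ^ μ * B) ^ 2) by ring, sqrt_mul (by positivity),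
    sqrt_sq (by positivity)]

theorem gradMuNorm_congr {μ : ℝ} {d k : ℕ}
    {u v : EuclideanSpace ℝ (Fin d) × EuclideanSpace ℝ (Fin k) → ℝ}
    {z : EuclideanSpace ℝ (Fin d) × EuclideanSpace ℝ (Fin k)} (h : u =ᶠ[nhds z] v) :
    gradMuNorm μ u z = gradMuNorm μ v z := by
  have hx : (fun x => u (x, z.2)) =ᶠ[nhds z.1] fun x => v (x, z.2) :=
    (Continuous.tendsto (f := fun x => (x, z.2)) (by fun_prop) z.1).eventually h
  have hy : (fun y => u (z.1, y)) =ᶠ[nhds z.2] fun y => v (z.1, y) :=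
    (Continuous.tendsto (f := fun y => (z.1, y)) (by fun_prop) z.2).eventually h
  rw [gradMuNorm_eq, gradMuNorm_eq, norm_gradient, norm_gradient, norm_gradient, norm_gradient,
    hx.fderiv_eq, hy.fderiv_eq]

theorem gradMuNorm_zero (μ : ℝ) {d k : ℕ}
    (z : EuclideanSpace ℝ (Fin d) × EuclideanSpace ℝ (Fin k)) : gradMuNorm μ 0 z = 0 := by
  rw [gradMuNorm_eq, norm_gradient, norm_gradient]
  simp

theorem continuous_gradMuNorm {μ : ℝ} (hμ : 0 < μ) {d k : ℕ}
    {u : EuclideanSpace ℝ (Fin d) × EuclideanSpace ℝ (Fin k) → ℝ}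
    (hu : ContDiff ℝ (⊤ : ℕ∞) u) : Continuous (gradMuNorm μ u) := by
  have hdiff : Differentiable ℝ u := hu.differentiable (by simp)
  have hfd : Continuous (fderiv ℝ u) := hu.continuous_fderiv (by simp)
  have hx (z : EuclideanSpace ℝ (Fin d) × EuclideanSpace ℝ (Fin k)) :
      fderiv ℝ (fun x => u (x, z.2)) z.1 = (fderiv ℝ u z).comp (.inl ℝ _ _) :=
    ((hdiff z).hasFDerivAt.comp z.1 (hasFDerivAt_prodMk_left z.1 z.2)).fderiv
  have hy (z : EuclideanSpace ℝ (Fin d) × EuclideanSpace ℝ (Fin k)) :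
      fderiv ℝ (fun y => u (z.1, y)) z.2 = (fderiv ℝ u z).comp (.inr ℝ _ _) :=
    ((hdiff z).hasFDerivAt.comp z.2 (hasFDerivAt_prodMk_right z.1 z.2)).fderiv
  have hpow : Continuous fun z : EuclideanSpace ℝ (Fin d) × EuclideanSpace ℝ (Fin k) =>
      ‖z.1‖ ^ μ := Continuous.rpow_const (by fun_prop) fun _ => .inr hμ.le
  rw [show gradMuNorm μ u = _ from funext (gradMuNorm_eq μ u)]
  simp_rw [norm_gradient, hx, hy]
  fun_prop

/-- A functional density depending only on germs and homogeneous of degree `Q` under the action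
`u ↦ t ^ s • (u ∘ δ_t)` of the dilations. -/
structure IsDilationCovariant (μ s Q : ℝ) {d k : ℕ}
    (Φ : (EuclideanSpace ℝ (Fin d) × EuclideanSpace ℝ (Fin k) → ℝ) →
      EuclideanSpace ℝ (Fin d) × EuclideanSpace ℝ (Fin k) → ℝ) : Prop where
  congr : ∀ u v z, u =ᶠ[nhds z] v → Φ u z = Φ v z
  zero : ∀ z, Φ 0 z = 0
  scale : ∀ t, 0 < t → ∀ u z,
    Φ (fun w => t ^ s * u (dilation μ t w)) z = t ^ Q * Φ u (dilation μ t z)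

/-- The density of the weighted `L^m` norm. -/
noncomputable def weightedDensity (μ m b e : ℝ) {d k : ℕ}
    (u : EuclideanSpace ℝ (Fin d) × EuclideanSpace ℝ (Fin k) → ℝ)
    (z : EuclideanSpace ℝ (Fin d) × EuclideanSpace ℝ (Fin k)) : ℝ :=
  (‖z.1‖ ^ μ / grho μ z ^ μ) ^ b * grho μ z ^ e * |u z| ^ m

/-- The density of the weighted `L^m` norm of the Grushin gradient. -/
noncomputable def gradDensity (μ m e : ℝ) {d k : ℕ}
    (u : EuclideanSpace ℝ (Fin d) × EuclideanSpace ℝ (Fin k) → ℝ)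
    (z : EuclideanSpace ℝ (Fin d) × EuclideanSpace ℝ (Fin k)) : ℝ :=
  grho μ z ^ e * gradMuNorm μ u z ^ m

theorem isDilationCovariant_weightedDensity {μ s Q m b e : ℝ} (hμ : 0 < μ) (hm : 0 < m)
    (hs : s * m = Q + e) {d k : ℕ} :
    IsDilationCovariant μ s Q (weightedDensity μ m b e (d := d) (k := k)) where
  congr u v z h := by simp only [weightedDensity, h.eq_of_nhds]
  zero z := by simp [weightedDensity, zero_rpow hm.ne']
  scale t ht u z := by
    simp only [weightedDensity]
    rw [grho_dilation hμ ht, norm_dilation_fst μ ht, abs_mul, abs_of_pos (by positivity),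
      mul_rpow (by positivity) (abs_nonneg _), ← rpow_mul ht.le, hs,
      mul_rpow ht.le (norm_nonneg _), mul_rpow ht.le (grho_nonneg _ _),
      mul_rpow ht.le (grho_nonneg _ _), mul_div_mul_left _ _ (rpow_pos_of_pos ht μ).ne',
      rpow_add ht]
    ring

theorem isDilationCovariant_gradDensity {μ s Q m e : ℝ} (hμ : 0 < μ) (hm : 0 < m)
    (hs : (s + 1) * m = Q + e) {d k : ℕ} :
    IsDilationCovariant μ s Q (gradDensity μ m e (d := d) (k := k)) where
  congr u v z h := by simp only [gradDensity, gradMuNorm_congr h]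
  zero z := by simp [gradDensity, gradMuNorm_zero, zero_rpow hm.ne']
  scale t ht u z := by
    have hts : t ^ s * t = t ^ (s + 1) := by rw [rpow_add ht, rpow_one]
    simp only [gradDensity]
    rw [gradMuNorm_mul_comp_dilation (by positivity) ht, grho_dilation hμ ht, hts,
      mul_rpow (by positivity) (show 0 ≤ gradMuNorm μ u _ from sqrt_nonneg _), ← rpow_mul ht.le, hs,
      mul_rpow ht.le (grho_nonneg _ _), rpow_add ht]
    ring

/-- The superposition of `N` dilates of `φ`, at scales `4 ^ j`. -/
noncomputable def dilateSum (μ s : ℝ) {d k : ℕ}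
    (φ : EuclideanSpace ℝ (Fin d) × EuclideanSpace ℝ (Fin k) → ℝ) (N : ℕ)
    (z : EuclideanSpace ℝ (Fin d) × EuclideanSpace ℝ (Fin k)) : ℝ :=
  ∑ j ∈ Finset.range N, ((4 : ℝ) ^ j) ^ s * φ (dilation μ (4 ^ j) z)

theorem contDiff_dilateSum {μ s : ℝ} {d k : ℕ}
    {φ : EuclideanSpace ℝ (Fin d) × EuclideanSpace ℝ (Fin k) → ℝ} (hφ : ContDiff ℝ (⊤ : ℕ∞) φ)
    (N : ℕ) : ContDiff ℝ (⊤ : ℕ∞) (dilateSum μ s φ N) :=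
  .sum fun _ _ => contDiff_const.mul (hφ.comp (contDiff_dilation _ _))

theorem hasCompactSupport_dilateSum {μ s : ℝ} {d k : ℕ}
    {φ : EuclideanSpace ℝ (Fin d) × EuclideanSpace ℝ (Fin k) → ℝ} (hφ : HasCompactSupport φ)
    (N : ℕ) : HasCompactSupport (dilateSum μ s φ N) := by
  rw [show dilateSum μ s φ N = ∑ j ∈ Finset.range N,
    fun z => ((4 : ℝ) ^ j) ^ s * φ (dilation μ (4 ^ j) z) by
      ext z; simp [dilateSum, Finset.sum_apply]]
  refine Finset.sum_induction _ HasCompactSupport (fun _ _ => HasCompactSupport.add)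
    HasCompactSupport.zero fun j _ => HasCompactSupport.mul_left ?_
  exact hφ.comp_homeomorph (dilationHomeomorph μ (4 ^ j) (by positivity) d k)

theorem eventuallyEq_zero_of_notMem_annulus {μ c t : ℝ} (ht : 0 < t) {d k : ℕ}
    {φ : EuclideanSpace ℝ (Fin d) × EuclideanSpace ℝ (Fin k) → ℝ}
    (hφ : ∀ z, φ z ≠ 0 → ‖z.1‖ ∈ Set.Icc (1 / 2 : ℝ) (3 / 2))
    {z : EuclideanSpace ℝ (Fin d) × EuclideanSpace ℝ (Fin k)}
    (hz : t * ‖z.1‖ ∉ Set.Icc (1 / 2 : ℝ) (3 / 2)) :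
    (fun w => c * φ (dilation μ t w)) =ᶠ[nhds z] 0 := by
  have hopen : IsOpen {w : EuclideanSpace ℝ (Fin d) × EuclideanSpace ℝ (Fin k) |
      t * ‖w.1‖ ∈ (Set.Icc (1 / 2 : ℝ) (3 / 2))ᶜ} :=
    isClosed_Icc.isOpen_compl.preimage (by fun_prop)
  filter_upwards [hopen.mem_nhds hz] with w hw
  by_contra h
  refine hw ?_
  rw [← norm_dilation_fst μ ht]
  exact hφ _ fun h0 => h (by simp [h0])

theorem eq_of_mem_annulus {i j : ℕ} {x : ℝ}
    (hi : 4 ^ i * x ∈ Set.Icc (1 / 2 : ℝ) (3 / 2))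
    (hj : 4 ^ j * x ∈ Set.Icc (1 / 2 : ℝ) (3 / 2)) : i = j := by
  have key {i j : ℕ} (hi : 4 ^ i * x ∈ Set.Icc (1 / 2 : ℝ) (3 / 2))
      (hj : 4 ^ j * x ∈ Set.Icc (1 / 2 : ℝ) (3 / 2)) : ¬ i < j := fun hlt => by
    obtain ⟨n, rfl⟩ := Nat.exists_eq_add_of_lt hlt
    have h1 : (1 : ℝ) ≤ 4 ^ n := one_le_pow₀ (by norm_num)
    have : (4 : ℝ) ^ (i + n + 1) * x = 4 * (4 ^ n * (4 ^ i * x)) := by ring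
    rw [this] at hj
    nlinarith [hi.1, hj.2]
  exact le_antisymm (not_lt.1 (key hj hi)) (not_lt.1 (key hi hj))

namespace IsDilationCovariant

variable {μ s Q : ℝ} {d k : ℕ}
  {Φ : (EuclideanSpace ℝ (Fin d) × EuclideanSpace ℝ (Fin k) → ℝ) →
    EuclideanSpace ℝ (Fin d) × EuclideanSpace ℝ (Fin k) → ℝ}
  {φ : EuclideanSpace ℝ (Fin d) × EuclideanSpace ℝ (Fin k) → ℝ}

theorem apply_dilateSum (hΦ : IsDilationCovariant μ s Q Φ)
    (hφ : ∀ z, φ z ≠ 0 → ‖z.1‖ ∈ Set.Icc (1 / 2 : ℝ) (3 / 2)) (N : ℕ)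
    (z : EuclideanSpace ℝ (Fin d) × EuclideanSpace ℝ (Fin k)) :
    Φ (dilateSum μ s φ N) z =
      ∑ j ∈ Finset.range N, ((4 : ℝ) ^ j) ^ Q * Φ φ (dilation μ (4 ^ j) z) := by
  have hgerm (i : ℕ) (hi : 4 ^ i * ‖z.1‖ ∉ Set.Icc (1 / 2 : ℝ) (3 / 2)) :
      (fun w => ((4 : ℝ) ^ i) ^ s * φ (dilation μ (4 ^ i) w)) =ᶠ[nhds z] 0 :=
    eventuallyEq_zero_of_notMem_annulus (by positivity) hφ hi
  have hterm (i : ℕ) (hi : 4 ^ i * ‖z.1‖ ∉ Set.Icc (1 / 2 : ℝ) (3 / 2)) :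
      ((4 : ℝ) ^ i) ^ Q * Φ φ (dilation μ (4 ^ i) z) = 0 := by
    rw [← hΦ.scale _ (by positivity), hΦ.congr _ _ _ (hgerm i hi), hΦ.zero]
  by_cases h : ∃ j ∈ Finset.range N, 4 ^ j * ‖z.1‖ ∈ Set.Icc (1 / 2 : ℝ) (3 / 2)
  · obtain ⟨j, hjN, hj⟩ := h
    have hne (i : ℕ) (hi : i ≠ j) : 4 ^ i * ‖z.1‖ ∉ Set.Icc (1 / 2 : ℝ) (3 / 2) :=
      fun h => hi (eq_of_mem_annulus h hj)
    rw [Finset.sum_eq_single_of_mem j hjN fun i _ hi => hterm i (hne i hi),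
      ← hΦ.scale _ (by positivity)]
    refine hΦ.congr _ _ _ ?_
    have hall : ∀ᶠ w in nhds z, ∀ i ∈ (Finset.range N).erase j,
        ((4 : ℝ) ^ i) ^ s * φ (dilation μ (4 ^ i) w) = 0 :=
      (Filter.eventually_all_finset _).2 fun i hi => hgerm i (hne i (Finset.ne_of_mem_erase hi))
    filter_upwards [hall] with w hw
    exact Finset.sum_eq_single_of_mem j hjN fun i hi hij =>
      hw i (Finset.mem_erase.2 ⟨hij, hi⟩)
  · push Not at h
    rw [Finset.sum_eq_zero fun i hi => hterm i (h i hi), ← hΦ.zero z]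
    refine hΦ.congr _ _ _ ?_
    have hall : ∀ᶠ w in nhds z, ∀ i ∈ Finset.range N,
        ((4 : ℝ) ^ i) ^ s * φ (dilation μ (4 ^ i) w) = 0 :=
      (Filter.eventually_all_finset _).2 fun i hi => hgerm i (h i hi)
    filter_upwards [hall] with w hw
    exact Finset.sum_eq_zero hw

theorem integral_dilateSum (hΦ : IsDilationCovariant μ s Q Φ) (hQ : Q = d + (1 + μ) * k)
    (hφ : ∀ z, φ z ≠ 0 → ‖z.1‖ ∈ Set.Icc (1 / 2 : ℝ) (3 / 2)) (hint : Integrable (Φ φ)) (N : ℕ) :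
    ∫ z, Φ (dilateSum μ s φ N) z = N * ∫ z, Φ φ z := by
  simp_rw [hΦ.apply_dilateSum hφ]
  rw [integral_finsetSum _ fun j _ =>
    (integrable_comp_dilation (by positivity) hint).const_mul _]
  have hone (j : ℕ) : ∫ z, ((4 : ℝ) ^ j) ^ Q * Φ φ (dilation μ (4 ^ j) z) = ∫ z, Φ φ z := by
    rw [integral_const_mul, integral_comp_dilation (by positivity), ← hQ, ← mul_assoc,
      ← rpow_add (by positivity), add_neg_cancel, rpow_zero, one_mul]
  simp [hone]

theorem integrable (hΦ : IsDilationCovariant μ s Q Φ) (hc : HasCompactSupport φ)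
    (hφ : tsupport φ ⊆ {z | z.1 ≠ 0}) (hcont : ContinuousOn (Φ φ) {z | z.1 ≠ 0}) :
    Integrable (Φ φ) := by
  have hsupp : Function.support (Φ φ) ⊆ tsupport φ := fun z hz => by
    by_contra h
    exact hz ((hΦ.congr _ _ _ (notMem_tsupport_iff_eventuallyEq.1 h)).trans (hΦ.zero z))
  exact (integrableOn_iff_integrable_of_support_subset hsupp).1
    ((hcont.mono hφ).integrableOn_compact hc)

end IsDilationCovariant

theorem continuousOn_weightedDensity {μ m b e : ℝ} (hμ : 0 < μ) (hm : 0 < m) {d k : ℕ}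
    {u : EuclideanSpace ℝ (Fin d) × EuclideanSpace ℝ (Fin k) → ℝ} (hu : Continuous u) :
    ContinuousOn (weightedDensity μ m b e u) {z | z.1 ≠ 0} := by
  have hρ := (continuous_grho hμ (d := d) (k := k)).continuousOn (s := {z | z.1 ≠ 0})
  have hρ0 : ∀ z ∈ {z : EuclideanSpace ℝ (Fin d) × EuclideanSpace ℝ (Fin k) | z.1 ≠ 0},
      grho μ z ≠ 0 := fun z hz => (grho_pos hz).ne'
  have hx : ContinuousOn (fun z : EuclideanSpace ℝ (Fin d) × EuclideanSpace ℝ (Fin k) =>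
      ‖z.1‖ ^ μ) {z | z.1 ≠ 0} :=
    (Continuous.rpow_const (by fun_prop) fun _ => .inr hμ.le).continuousOn
  refine ContinuousOn.mul (.mul (.rpow_const (.div hx (hρ.rpow_const fun z hz => .inl (hρ0 z hz))
    fun z hz => ?_) fun z hz => .inl ?_) (hρ.rpow_const fun z hz => .inl (hρ0 z hz)))
    (Continuous.rpow_const (by fun_prop) fun _ => .inr hm.le).continuousOn
  · exact (rpow_pos_of_pos (grho_pos hz) _).ne'
  · have := grho_pos (μ := μ) hz
    have := norm_pos_iff.2 hz
    positivity

theorem continuousOn_gradDensity {μ m e : ℝ} (hμ : 0 < μ) (hm : 0 < m) {d k : ℕ}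
    {u : EuclideanSpace ℝ (Fin d) × EuclideanSpace ℝ (Fin k) → ℝ}
    (hu : ContDiff ℝ (⊤ : ℕ∞) u) :
    ContinuousOn (gradDensity μ m e u) {z | z.1 ≠ 0} :=
  ((continuous_grho hμ).continuousOn.rpow_const fun _ hz => .inl (grho_pos hz).ne').mul
    ((continuous_gradMuNorm hμ hu).rpow_const fun _ => .inr hm.le).continuousOn

theorem weightedDensity_nonneg {μ m b e : ℝ} {d k : ℕ}
    (u : EuclideanSpace ℝ (Fin d) × EuclideanSpace ℝ (Fin k) → ℝ) :
    0 ≤ weightedDensity μ m b e u := fun z => by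
  have := grho_nonneg μ z
  simp only [Pi.zero_apply, weightedDensity]
  positivity

theorem gradDensity_nonneg {μ m e : ℝ} {d k : ℕ}
    (u : EuclideanSpace ℝ (Fin d) × EuclideanSpace ℝ (Fin k) → ℝ) :
    0 ≤ gradDensity μ m e u := fun z => by
  have := grho_nonneg μ z
  have : 0 ≤ gradMuNorm μ u z := sqrt_nonneg _
  simp only [Pi.zero_apply, gradDensity]
  positivity

theorem integral_weightedDensity_pos {μ m b e : ℝ} {d k : ℕ}
    {u : EuclideanSpace ℝ (Fin d) × EuclideanSpace ℝ (Fin k) → ℝ} (hu : Continuous u)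
    (hint : Integrable (weightedDensity μ m b e u))
    {z₀ : EuclideanSpace ℝ (Fin d) × EuclideanSpace ℝ (Fin k)} (hz₀ : z₀.1 ≠ 0) (hu₀ : u z₀ ≠ 0) :
    0 < ∫ z, weightedDensity μ m b e u z := by
  rw [integral_pos_iff_support_of_nonneg (weightedDensity_nonneg u) hint]
  have hopen : IsOpen {z : EuclideanSpace ℝ (Fin d) × EuclideanSpace ℝ (Fin k) |
      z.1 ≠ 0 ∧ u z ≠ 0} :=
    (isOpen_ne_fun continuous_fst continuous_const).inter (isOpen_ne_fun hu continuous_const)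
  refine (hopen.measure_pos volume ⟨z₀, hz₀, hu₀⟩).trans_le (measure_mono fun z hz => ?_)
  have := grho_pos (μ := μ) hz.1
  have := norm_pos_iff.2 hz.1
  have := abs_pos.2 hz.2
  simp only [Function.mem_support, weightedDensity]
  positivity

/-- A bump function whose support avoids `x = 0`. -/
theorem exists_bump_annulus {d k : ℕ} (hd : 1 ≤ d) :
    ∃ φ : EuclideanSpace ℝ (Fin d) × EuclideanSpace ℝ (Fin k) → ℝ,
      ContDiff ℝ (⊤ : ℕ∞) φ ∧ HasCompactSupport φ ∧
      (∀ z ∈ tsupport φ, ‖z.1‖ ∈ Set.Icc (1 / 2 : ℝ) (3 / 2)) ∧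
      ∃ z, z.1 ≠ 0 ∧ φ z ≠ 0 := by
  obtain ⟨e, he⟩ : ∃ e : EuclideanSpace ℝ (Fin d), ‖e‖ = 1 :=
    ⟨EuclideanSpace.single ⟨0, hd⟩ 1, by simp⟩
  let φ : ContDiffBump ((e, 0) : EuclideanSpace ℝ (Fin d) × EuclideanSpace ℝ (Fin k)) :=
    ⟨1 / 4, 1 / 2, by norm_num, by norm_num⟩
  refine ⟨φ, φ.contDiff, φ.hasCompactSupport, fun z hz => ?_, (e, 0), ?_, ?_⟩
  · rw [φ.tsupport_eq, Metric.mem_closedBall, dist_eq_norm] at hz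
    have h1 : ‖z.1 - e‖ ≤ 1 / 2 := (norm_fst_le (z - (e, 0))).trans hz
    have h2 := norm_sub_norm_le e z.1
    have h3 := norm_sub_norm_le z.1 e
    rw [norm_sub_rev] at h2
    constructor <;> linarith
  · exact norm_pos_iff.1 (he ▸ one_pos)
  · rw [φ.one_of_mem_closedBall (Metric.mem_closedBall_self (by norm_num))]
    exact one_ne_zero

theorem nonpos_of_forall_rpow_le {s M : ℝ}
    (h : ∀ N : ℕ, 0 < N → (N : ℝ) ^ s ≤ M) : s ≤ 0 := by
  by_contra! hs
  obtain ⟨N, hN, hN0⟩ := (((tendsto_rpow_atTop hs).comp tendsto_natCast_atTop_atTop).eventually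
    (Filter.eventually_gt_atTop M)).and (Filter.eventually_gt_atTop 0) |>.exists
  exact (h N hN0).not_gt hN

/-- Necessity of `α - σ ≤ 1` in the boundary case of the weighted CKN inequality. -/
theorem weighted_CKN_grushin_necessity_boundary
    (d k : ℕ) (hd : 1 ≤ d) (hk : 1 ≤ k) (μ : ℝ) (hμ : 0 < μ)
    (Q : ℝ) (hQ : Q = d + (1 + μ) * k)
    (p q r a α β σ γ : ℝ)
    (hγ : γ = a * σ + (1 - a) * β)
    (hp1 : 1 < p) (hpQ : p < Q) (hq : 1 ≤ q) (hr : 0 < r)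
    (h1 : 0 < d + μ * (α - γ) * r) (h2 : 0 < d + μ * (α - β) * q)
    (h3 : 0 < α * p + Q) (h4 : 0 < β * q + Q) (h5 : 0 < γ * r + Q)
    (ha0 : 0 < a) (ha1 : a ≤ 1)
    (hbal : 1 / r + γ / Q = a * (1 / p + (α - 1) / Q) + (1 - a) * (1 / q + β / Q))
    (hbd : 1 / p + (α - 1) / Q = 1 / r + γ / Q)
    (hCKN : ∃ C : ℝ, 0 < C ∧
        ∀ u : EuclideanSpace ℝ (Fin d) × EuclideanSpace ℝ (Fin k) → ℝ,
          ContDiff ℝ (⊤ : ℕ∞) u → HasCompactSupport u →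
          (∫ z, (‖z.1‖ ^ μ / grho μ z ^ μ) ^ ((α - γ) * r) * grho μ z ^ (γ * r) * |u z| ^ r) ^ (1 / r)
            ≤ C * (∫ z, grho μ z ^ (α * p) * gradMuNorm μ u z ^ p) ^ (a / p) *
              (∫ z, (‖z.1‖ ^ μ / grho μ z ^ μ) ^ ((α - β) * q) * grho μ z ^ (β * q) * |u z| ^ q) ^
                ((1 - a) / q)) :
    α - σ ≤ 1 := by
  have hp0 : 0 < p := one_pos.trans hp1
  have hq0 : 0 < q := one_pos.trans_le hq
  have hQ0 : 0 < Q := hp0.trans hpQ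
  obtain ⟨C, hC, hineq⟩ := hCKN
  obtain ⟨φ, hφs, hφc, hφt, z₀, hz₀, hφ₀⟩ := exists_bump_annulus (k := k) hd
  have hφ : ∀ z, φ z ≠ 0 → ‖z.1‖ ∈ Set.Icc (1 / 2 : ℝ) (3 / 2) :=
    fun z hz => hφt z (subset_tsupport φ hz)
  have hφt0 : tsupport φ ⊆ {z | z.1 ≠ 0} := fun z hz h0 => by
    have := (hφt z hz).1
    norm_num [h0] at this
  obtain ⟨s, hs⟩ : ∃ s, s = Q * (1 / r + γ / Q) := ⟨_, rfl⟩
  have hsr : s * r = Q + γ * r := by rw [hs]; field_simp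
  have hsp : (s + 1) * p = Q + α * p := by rw [hs, ← hbd]; field_simp; ring
  have hA := isDilationCovariant_weightedDensity (b := (α - γ) * r) (d := d) (k := k) hμ hr hsr
  have hB := isDilationCovariant_gradDensity (d := d) (k := k) hμ hp0 hsp
  have hAi := hA.integrable hφc hφt0 (continuousOn_weightedDensity hμ hr hφs.continuous)
  have hBi := hB.integrable hφc hφt0 (continuousOn_gradDensity hμ hp0 hφs)
  have hA0 := integral_weightedDensity_pos hφs.continuous hAi hz₀ hφ₀
  have hB0 : 0 ≤ ∫ z, gradDensity μ p (α * p) φ z := integral_nonneg (gradDensity_nonneg φ)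
  obtain ⟨D, hD⟩ : ∃ D : ℝ, ∀ N : ℕ,
      (∫ z, weightedDensity μ q ((α - β) * q) (β * q) (dilateSum μ s φ N) z) ^ ((1 - a) / q) =
        (N : ℝ) ^ ((1 - a) / q) * D := by
    rcases ha1.eq_or_lt with rfl | ha1
    · exact ⟨1, fun N => by simp⟩
    have hqβ : 1 / r + γ / Q = 1 / q + β / Q := by
      rw [hbd] at hbal
      exact mul_left_cancel₀ (sub_pos.2 ha1).ne' (by linarith)
    have hsq : s * q = Q + β * q := by rw [hs, hqβ]; field_simp
    have hE := isDilationCovariant_weightedDensity (b := (α - β) * q) (d := d) (k := k) hμ hq0 hsq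
    have hEi := hE.integrable hφc hφt0 (continuousOn_weightedDensity hμ hq0 hφs.continuous)
    exact ⟨_, fun N => by
      rw [hE.integral_dilateSum hQ hφ hEi,
        mul_rpow N.cast_nonneg (integral_nonneg (weightedDensity_nonneg φ))]⟩
  set A := ∫ z, weightedDensity μ r ((α - γ) * r) (γ * r) φ z
  set B := ∫ z, gradDensity μ p (α * p) φ z
  have hexp : 1 / r - (a / p + (1 - a) / q) ≤ 0 := by
    refine nonpos_of_forall_rpow_le (M := C * B ^ (a / p) * D / A ^ (1 / r)) fun N hN => ?_
    have hN' : (0 : ℝ) < N := Nat.cast_pos.2 hN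
    have h := hineq _ (contDiff_dilateSum hφs N)
      (hasCompactSupport_dilateSum (μ := μ) (s := s) hφc N)
    change (∫ z, weightedDensity μ r ((α - γ) * r) (γ * r) (dilateSum μ s φ N) z) ^ (1 / r) ≤
      C * (∫ z, gradDensity μ p (α * p) (dilateSum μ s φ N) z) ^ (a / p) *
        (∫ z, weightedDensity μ q ((α - β) * q) (β * q) (dilateSum μ s φ N) z) ^ ((1 - a) / q) at h
    rw [hD, hA.integral_dilateSum hQ hφ hAi, hB.integral_dilateSum hQ hφ hBi,
      mul_rpow hN'.le hA0.le, mul_rpow hN'.le hB0] at h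
    rw [rpow_sub hN', rpow_add hN', div_le_div_iff₀ (by positivity) (by positivity)]
    linarith
  have hid : 1 / r - (a / p + (1 - a) / q) = a * (α - σ - 1) / Q := by
    rw [hγ] at hbal
    have : 1 / r = a * (1 / p + (α - 1) / Q) + (1 - a) * (1 / q + β / Q) -
      (a * σ + (1 - a) * β) / Q := by linarith
    rw [this]
    ring
  rw [hid] at hexp
  by_contra! hlt
  have : 0 < a * (α - σ - 1) / Q := div_pos (mul_pos ha0 (by linarith)) hQ0
  linarith
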